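/- arXiv:2407.04872 — 4 statements merged into one kernel-verified Lean document; each statement's English description precedes it below -/
import Mathlib

section
/- Let h, r ∈ ℕ, let s, t ∈ V, and let U ⊆ N satisfy d^h(s,u) + d^h(u,t) ≤ 0 for every u ∈ U (a weak h-hop negative sandwich). Assume that d^{r+h}(s,v) and d^{r+h}(v,t) are finite for every v ∈ V, and define φ(v) = max(d^{r+h}(s,v), −d^{r+h}(v,t)). Then: (i) φ is a valid potential; and (ii) for every u ∈ U and every v ∈ V with d^{r+h}(s,v) + d^{r+h}(v,t) ≥ 0, one has d^r(u,v) + φ(u) − φ(v) ≥ 0. In particular, if a vertex v admits a walk from some u ∈ U with at most r hops (hops counted with respect to the negative edges of ℓ) whose ℓ_φ-length is negative, then d^{r+h}(s,v) + d^{r+h}(v,t) < 0. -/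
open scoped Classical

variable {V : Type*}

/-- `l` is a (nonempty) walk in the edge set `E`: a list of at least one vertex,
with every consecutive pair of vertices being an edge of `E`.
A single-vertex list is the empty walk at that vertex. -/
def IsWalk (E : Set (V × V)) (l : List V) : Prop :=
  l ≠ [] ∧ l.Chain' (fun a b => (a, b) ∈ E)

/-- `l` is a walk in `E` from `s` to `t`. -/
def IsWalkFrom (E : Set (V × V)) (l : List V) (s t : V) : Prop :=
  IsWalk E l ∧ l.head? = some s ∧ l.getLast? = some t

/-- The edges of a walk, in order, with multiplicity. -/
def walkEdges (l : List V) : List (V × V) := l.zip l.tail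

/-- The length of a walk with respect to edge lengths `ℓ`. -/
noncomputable def walkLen (ℓ : V × V → ℝ) (l : List V) : ℝ :=
  ((walkEdges l).map ℓ).sum

/-- The tails of the negative edges along a walk, in order, with multiplicity. -/
noncomputable def negTails (ℓ : V × V → ℝ) (l : List V) : List V :=
  ((walkEdges l).filter (fun p => ℓ p < 0)).map Prod.fst

/-- The number of hops (negative edges, counted with multiplicity) of a walk. -/
noncomputable def hops (ℓ : V × V → ℝ) (l : List V) : ℕ :=
  (negTails ℓ l).length

/-- The set of negative vertices: tails of negative edges. -/
def negVerts (E : Set (V × V)) (ℓ : V × V → ℝ) : Set V :=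
  {u | ∃ v, (u, v) ∈ E ∧ ℓ (u, v) < 0}

/-- `r`-hop distance: infimum (in the extended reals) of lengths of walks
from `s` to `t` with at most `r` hops. -/
noncomputable def hopDist (E : Set (V × V)) (ℓ : V × V → ℝ) (r : ℕ) (s t : V) : EReal :=
  sInf {x : EReal | ∃ l, IsWalkFrom E l s t ∧ hops ℓ l ≤ r ∧ x = (walkLen ℓ l : ℝ)}

/-- Distance: infimum (in the extended reals) of lengths of all walks from `s` to `t`. -/
noncomputable def dist' (E : Set (V × V)) (ℓ : V × V → ℝ) (s t : V) : EReal :=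
  sInf {x : EReal | ∃ l, IsWalkFrom E l s t ∧ x = (walkLen ℓ l : ℝ)}

/-- Proper `h`-hop distance: infimum of lengths of walks from `s` to `t` with
exactly `h` negative edges whose tails are pairwise distinct. -/
noncomputable def properHopDist (E : Set (V × V)) (ℓ : V × V → ℝ) (h : ℕ) (s t : V) : EReal :=
  sInf {x : EReal | ∃ l, IsWalkFrom E l s t ∧ hops ℓ l = h ∧ (negTails ℓ l).Nodup
    ∧ x = (walkLen ℓ l : ℝ)}

/-- `r`-hop distance from a set of sources. -/
noncomputable def hopDistFromSet (E : Set (V × V)) (ℓ : V × V → ℝ) (r : ℕ) (S : Set V)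
    (t : V) : EReal :=
  ⨅ s ∈ S, hopDist E ℓ r s t

/-- `r`-hop distance to a set of sinks. -/
noncomputable def hopDistToSet (E : Set (V × V)) (ℓ : V × V → ℝ) (r : ℕ) (s : V)
    (T : Set V) : EReal :=
  ⨅ t ∈ T, hopDist E ℓ r s t

/-- `φ` is a valid potential for edge lengths `ℓ`: reweighting introduces no new
negative edges. -/
def ValidPotential (E : Set (V × V)) (ℓ : V × V → ℝ) (φ : V → ℝ) : Prop :=
  ∀ e ∈ E, 0 ≤ ℓ e → 0 ≤ ℓ e + φ e.1 - φ e.2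

/-- The reweighted edge lengths `ℓ_φ`. -/
def reweight (ℓ : V × V → ℝ) (φ : V → ℝ) : V × V → ℝ :=
  fun e => ℓ e + φ e.1 - φ e.2

theorem walkLen_cons_cons (ℓ : V × V → ℝ) (x y : V) (l : List V) :
    walkLen ℓ (x :: y :: l) = ℓ (x, y) + walkLen ℓ (y :: l) := by
  simp [walkLen, walkEdges]

theorem hops_cons_cons (ℓ : V × V → ℝ) (x y : V) (l : List V) :
    hops ℓ (x :: y :: l) = (if ℓ (x, y) < 0 then 1 else 0) + hops ℓ (y :: l) := by
  by_cases hneg : ℓ (x, y) < 0 <;>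
    simp [hops, negTails, walkEdges, hneg, add_comm]

theorem walkLen_singleton (ℓ : V × V → ℝ) (x : V) : walkLen ℓ [x] = 0 := by
  simp [walkLen, walkEdges]

theorem hops_singleton (ℓ : V × V → ℝ) (x : V) : hops ℓ [x] = 0 := by
  simp [hops, negTails, walkEdges]

/-- Walks with matching endpoints can be concatenated; lengths and hops add up. -/
theorem exists_isWalkFrom_concat (E : Set (V × V)) (ℓ : V × V → ℝ) {b c : V} {l₂ : List V}
    (h₂ : IsWalkFrom E l₂ b c) (l₁ : List V) :
    ∀ a, IsWalkFrom E l₁ a b → ∃ l, IsWalkFrom E l a c ∧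
      walkLen ℓ l = walkLen ℓ l₁ + walkLen ℓ l₂ ∧ hops ℓ l = hops ℓ l₁ + hops ℓ l₂ := by
  induction l₁ with
  | nil => intro a h₁; exact absurd rfl h₁.1.1
  | cons x l₁ ih =>
    intro a h₁
    obtain ⟨⟨-, hchain⟩, hhead, hlast⟩ := h₁
    obtain rfl : x = a := by simpa using hhead
    cases l₁ with
    | nil =>
      obtain rfl : x = b := by simpa using hlast
      exact ⟨l₂, h₂, by simp [walkLen_singleton], by simp [hops_singleton]⟩
    | cons y l₁ =>
      obtain ⟨hxy, hchain⟩ := List.isChain_cons_cons.1 hchain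
      obtain ⟨l, ⟨⟨hne, hl⟩, hlhead, hllast⟩, hlen, hhops⟩ :=
        ih y ⟨⟨by simp, hchain⟩, by simp, by simpa using hlast⟩
      cases l with
      | nil => exact absurd rfl hne
      | cons z l =>
        obtain rfl : z = y := by simpa using hlhead
        refine ⟨x :: z :: l, ⟨⟨by simp, List.isChain_cons_cons.2 ⟨hxy, hl⟩⟩, by simp,
          by simpa using hllast⟩, ?_, ?_⟩
        · rw [walkLen_cons_cons, walkLen_cons_cons, hlen, add_assoc]
        · rw [hops_cons_cons, hops_cons_cons, hhops, add_assoc]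

theorem walkLen_reweight (E : Set (V × V)) (ℓ : V × V → ℝ) (φ : V → ℝ) {b : V} (l : List V) :
    ∀ a, IsWalkFrom E l a b → walkLen (reweight ℓ φ) l = walkLen ℓ l + φ a - φ b := by
  induction l with
  | nil => intro a hl; exact absurd rfl hl.1.1
  | cons x l ih =>
    intro a hl
    obtain ⟨⟨-, hchain⟩, hhead, hlast⟩ := hl
    obtain rfl : x = a := by simpa using hhead
    cases l with
    | nil =>
      obtain rfl : x = b := by simpa using hlast
      simp [walkLen_singleton]
    | cons y l =>
      rw [walkLen_cons_cons, walkLen_cons_cons,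
        ih y ⟨⟨by simp, (List.isChain_cons_cons.1 hchain).2⟩, by simp, by simpa using hlast⟩]
      simp only [reweight]
      ring

theorem hopDist_le_walkLen (E : Set (V × V)) (ℓ : V × V → ℝ) {r : ℕ} {a b : V} {l : List V}
    (hl : IsWalkFrom E l a b) (hr : hops ℓ l ≤ r) : hopDist E ℓ r a b ≤ (walkLen ℓ l : ℝ) :=
  sInf_le ⟨l, hl, hr, rfl⟩

theorem hopDist_anti (E : Set (V × V)) (ℓ : V × V → ℝ) {m n : ℕ} (hmn : m ≤ n) (a b : V) :
    hopDist E ℓ n a b ≤ hopDist E ℓ m a b :=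
  sInf_le_sInf fun _ ⟨l, hl, hr, hx⟩ => ⟨l, hl, hr.trans hmn, hx⟩

theorem hopDist_le_hopDist_add_walkLen (E : Set (V × V)) (ℓ : V × V → ℝ) {m n : ℕ} {a b c : V}
    {l : List V} (hl : IsWalkFrom E l b c) (hn : hops ℓ l ≤ n) :
    hopDist E ℓ (m + n) a c ≤ hopDist E ℓ m a b + (walkLen ℓ l : ℝ) := by
  rw [← EReal.sub_le_iff_le_add (by simp) (by simp)]
  refine le_sInf ?_
  rintro _ ⟨l₁, hl₁, hm, rfl⟩
  obtain ⟨l', hl', hlen, hhops⟩ := exists_isWalkFrom_concat E ℓ hl l₁ a hl₁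
  rw [EReal.sub_le_iff_le_add (by simp) (by simp), ← EReal.coe_add, ← hlen]
  exact hopDist_le_walkLen E ℓ hl' (by omega)

theorem hopDist_le_walkLen_add_hopDist (E : Set (V × V)) (ℓ : V × V → ℝ) {m n : ℕ} {a b c : V}
    {l : List V} (hl : IsWalkFrom E l a b) (hm : hops ℓ l ≤ m) :
    hopDist E ℓ (m + n) a c ≤ (walkLen ℓ l : ℝ) + hopDist E ℓ n b c := by
  rw [add_comm (walkLen ℓ l : EReal), ← EReal.sub_le_iff_le_add (by simp) (by simp)]
  refine le_sInf ?_
  rintro _ ⟨l₂, hl₂, hn, rfl⟩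
  obtain ⟨l', hl', hlen, hhops⟩ := exists_isWalkFrom_concat E ℓ hl₂ l a hl
  rw [EReal.sub_le_iff_le_add (by simp) (by simp), ← EReal.coe_add, add_comm (walkLen ℓ l₂), ← hlen]
  exact hopDist_le_walkLen E ℓ hl' (by omega)

theorem isWalkFrom_edge (E : Set (V × V)) {x y : V} (hxy : (x, y) ∈ E) :
    IsWalkFrom E [x, y] x y :=
  ⟨⟨by simp, List.isChain_cons_cons.2 ⟨hxy, List.isChain_singleton _⟩⟩, by simp, by simp⟩

/-- Given a weak `h`-hop negative sandwich `(s, U, t)`, the potential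
`φ(v) = max (d^{r+h}(s,v), -d^{r+h}(v,t))` is valid, it makes every at-most-`r`-hop
walk from `U` to any vertex `v` with `d^{r+h}(s,v) + d^{r+h}(v,t) ≥ 0` nonnegative,
and hence any vertex negatively reachable from `U` by an at-most-`r`-hop walk
(hops with respect to `ℓ`) satisfies `d^{r+h}(s,v) + d^{r+h}(v,t) < 0`. -/
theorem statement0 {V : Type*} [Fintype V] (E : Set (V × V)) (ℓ : V × V → ℝ)
    (h r : ℕ) (s t : V) (U : Set V) (hU : U ⊆ negVerts E ℓ)
    (hsandwich : ∀ u ∈ U, hopDist E ℓ h s u + hopDist E ℓ h u t ≤ 0)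
    (hfin : ∀ v : V, (∃ x : ℝ, hopDist E ℓ (r + h) s v = (x : EReal)) ∧
      (∃ x : ℝ, hopDist E ℓ (r + h) v t = (x : EReal)))
    (φ : V → ℝ)
    (hφ : ∀ v : V, φ v = max (hopDist E ℓ (r + h) s v).toReal
      (-(hopDist E ℓ (r + h) v t).toReal)) :
    ValidPotential E ℓ φ ∧
    (∀ u ∈ U, ∀ v : V, 0 ≤ hopDist E ℓ (r + h) s v + hopDist E ℓ (r + h) v t →
      0 ≤ hopDist E ℓ r u v + (φ u : EReal) - (φ v : EReal)) ∧
    (∀ v : V, (∃ u ∈ U, ∃ l : List V, IsWalkFrom E l u v ∧ hops ℓ l ≤ r ∧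
        walkLen (reweight ℓ φ) l < 0) →
      hopDist E ℓ (r + h) s v + hopDist E ℓ (r + h) v t < 0) := by
  choose A hA using fun v => (hfin v).1
  choose B hB using fun v => (hfin v).2
  have hφ' : ∀ v, φ v = max (A v) (-B v) := fun v => by simp [hφ, hA, hB]
  -- A walk from `U` with at most `r` hops to a vertex outside the sandwich region.
  have key : ∀ u ∈ U, ∀ v : V, 0 ≤ A v + B v → ∀ l, IsWalkFrom E l u v → hops ℓ l ≤ r →
      0 ≤ walkLen ℓ l + φ u - φ v := by
    intro u hu v hv l hl hr
    have hs : (A u : EReal) ≤ hopDist E ℓ h s u :=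
      hA u ▸ hopDist_anti E ℓ (Nat.le_add_left h r) s u
    have ht : (B u : EReal) ≤ hopDist E ℓ h u t :=
      hB u ▸ hopDist_anti E ℓ (Nat.le_add_left h r) u t
    have hle : (A v : EReal) ≤ hopDist E ℓ h s u + (walkLen ℓ l : ℝ) := by
      rw [← hA v, add_comm r h]
      exact hopDist_le_hopDist_add_walkLen E ℓ hl hr
    have hst := hsandwich u hu
    generalize hopDist E ℓ h s u = a at hs hle hst
    generalize hopDist E ℓ h u t = b at ht hst
    have ha : a ≤ ((-B u : ℝ) : EReal) := by
      have := (add_le_add_right ht a).trans hst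
      rwa [← EReal.le_sub_iff_add_le (by simp) (by simp), zero_sub] at this
    have hlen : A v ≤ -B u + walkLen ℓ l := by
      exact_mod_cast hle.trans (add_le_add_left ha _)
    rw [hφ' v, max_eq_left (by linarith)]
    linarith [hφ' u, le_max_right (A u) (-B u)]
  have hiff : ∀ v, 0 ≤ hopDist E ℓ (r + h) s v + hopDist E ℓ (r + h) v t ↔ 0 ≤ A v + B v := by
    intro v
    rw [hA, hB]
    exact_mod_cast Iff.rfl
  refine ⟨?_, ?_, ?_⟩
  · rintro ⟨x, y⟩ hxy hnn
    have hw := isWalkFrom_edge E hxy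
    have hlen : walkLen ℓ [x, y] = ℓ (x, y) := by
      simp [walkLen_cons_cons, walkLen_singleton]
    have hhops : hops ℓ [x, y] ≤ 0 := by
      simp [hops_cons_cons, hops_singleton, hnn]
    have h₁ := hopDist_le_hopDist_add_walkLen E ℓ (m := r + h) (a := s) hw hhops
    have h₂ := hopDist_le_walkLen_add_hopDist E ℓ (n := r + h) (c := t) hw hhops
    rw [add_zero, hA, hA, hlen] at h₁
    rw [zero_add, hB, hB, hlen] at h₂
    norm_cast at h₁ h₂
    have : φ y ≤ ℓ (x, y) + φ x := by
      rw [hφ' y, hφ' x]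
      exact max_le (by linarith [le_max_left (A x) (-B x)])
        (by linarith [le_max_right (A x) (-B x)])
    simp only
    linarith
  · intro u hu v hv
    have hle : ((φ v - φ u : ℝ) : EReal) ≤ hopDist E ℓ r u v := by
      refine le_sInf ?_
      rintro _ ⟨l, hl, hr, rfl⟩
      exact_mod_cast (by linarith [key u hu v ((hiff v).1 hv) l hl hr] : φ v - φ u ≤ walkLen ℓ l)
    generalize hopDist E ℓ r u v = d at hle
    induction d with
    | bot => exact absurd (le_bot_iff.1 hle) (EReal.coe_ne_bot _)
    | top => simp [sub_eq_add_neg, ← EReal.coe_neg]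
    | coe d =>
      norm_cast at hle ⊢
      linarith
  · rintro v ⟨u, hu, l, hl, hr, hneg⟩
    by_contra hv
    have := key u hu v ((hiff v).1 (not_lt.1 hv)) l hl hr
    rw [walkLen_reweight E ℓ φ l u hl] at hneg
    linarith
end

section
/- For every S ⊆ N and every h ≥ 1, at least one of the following holds in G_S: (a) G_S contains a closed walk of negative length; (b) there exist s, t ∈ S with proper h-hop distance \hat d^h(s,t) < 0 in G_S; or (c) for every vertex v, d(V,v) = min(0, d^{h+1}(S,v)) in G_S. -/
open scoped Classical

variable {V : Type*}

/-- The length of a walk is additive under splitting the walk at a vertex. -/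
theorem walkLen_append_cons (ℓ : V × V → ℝ) (a : List V) (x : V) (b : List V) :
    walkLen ℓ (a ++ x :: b) = walkLen ℓ (a ++ [x]) + walkLen ℓ (x :: b) := by
  induction a with
  | nil => simp [walkLen_singleton]
  | cons u a ih =>
    cases a with
    | nil => simp [walkLen_cons_cons, walkLen_singleton]
    | cons w a =>
      simp only [List.cons_append, walkLen_cons_cons] at ih ⊢
      linarith

theorem List.map_fst_zip_sublist {α β : Type*} (l : List α) (m : List β) :
    ((l.zip m).map Prod.fst).Sublist l := by
  induction l generalizing m with
  | nil => simp
  | cons a l ih =>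
    cases m with
    | nil => simp
    | cons b m => simpa using ih m

/-- The tails of the negative edges of a walk form a sublist of its vertices. -/
theorem negTails_sublist (ℓ : V × V → ℝ) (l : List V) : (negTails ℓ l).Sublist l :=
  (List.filter_sublist.map _).trans (List.map_fst_zip_sublist l l.tail)

/-- A walk with more than `h` hops can be split at the tail of its `(h + 1)`-st negative edge. -/
theorem exists_split_of_lt_hops (ℓ : V × V → ℝ) (l : List V) (h : ℕ) (hl : h < hops ℓ l) :
    ∃ a x y b, l = a ++ x :: y :: b ∧ ℓ (x, y) < 0 ∧ hops ℓ (a ++ [x]) = h := by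
  induction l generalizing h with
  | nil => simp [hops, negTails, walkEdges] at hl
  | cons u l ih =>
    cases l with
    | nil => simp [hops_singleton] at hl
    | cons w l =>
      rw [hops_cons_cons] at hl
      by_cases huw : ℓ (u, w) < 0
      · cases h with
        | zero => exact ⟨[], u, w, l, rfl, huw, hops_singleton ℓ u⟩
        | succ k =>
          obtain ⟨a, x, y, b, hab, hxy, hk⟩ := ih k (by simp [huw] at hl; omega)
          refine ⟨u :: a, x, y, b, by simp [hab], hxy, ?_⟩
          cases a with
          | nil =>
            obtain ⟨rfl, -⟩ := List.cons.inj hab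
            simp_all [hops_cons_cons, hops_singleton, add_comm]
          | cons w' a =>
            obtain ⟨rfl, -⟩ := List.cons.inj hab
            simp only [List.cons_append, hops_cons_cons _ u] at hk ⊢
            simp [huw, hk, add_comm]
      · obtain ⟨a, x, y, b, hab, hxy, hk⟩ := ih h (by simpa [huw] using hl)
        refine ⟨u :: a, x, y, b, by simp [hab], hxy, ?_⟩
        cases a with
        | nil =>
          obtain ⟨rfl, -⟩ := List.cons.inj hab
          simp_all [hops_cons_cons, hops_singleton]
        | cons w' a =>
          obtain ⟨rfl, -⟩ := List.cons.inj hab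
          simp only [List.cons_append, hops_cons_cons _ u] at hk ⊢
          simp [huw, hk]

/-- A list with a repeated entry can be split at two occurrences of that entry. -/
theorem List.exists_split_of_not_nodup {α : Type*} {l : List α} (hl : ¬ l.Nodup) :
    ∃ a x b c, l = a ++ x :: (b ++ x :: c) := by
  induction l with
  | nil => simp at hl
  | cons u l ih =>
    by_cases hu : u ∈ l
    · obtain ⟨b, c, rfl⟩ := List.append_of_mem hu
      exact ⟨[], u, b, c, rfl⟩
    · obtain ⟨a, x, b, c, rfl⟩ := ih (by simpa [hu] using hl)
      exact ⟨u :: a, x, b, c, rfl⟩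

/-- Splitting a walk at a vertex yields two walks. -/
theorem isWalk_append_cons_iff (E : Set (V × V)) (a : List V) (x : V) (b : List V) :
    IsWalk E (a ++ x :: b) ↔ IsWalk E (a ++ [x]) ∧ IsWalk E (x :: b) := by
  constructor
  · rintro ⟨-, hc⟩
    exact ⟨⟨by simp, (List.isChain_split.1 hc).1⟩, by simp, (List.isChain_split.1 hc).2⟩
  · rintro ⟨⟨-, h₁⟩, -, h₂⟩
    exact ⟨by simp, List.isChain_split.2 ⟨h₁, h₂⟩⟩

/-- If there are no negative closed walks and no negative proper `h`-hop walks between vertices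
of `S`, then every walk of negative length can be replaced by one starting in `S` which is no
longer and has at most `h + 1` hops. -/
theorem nonneg_or_exists_walk_few_hops (E : Set (V × V)) (ℓ : V × V → ℝ) (S : Set V) (h : ℕ)
    (hh : 1 ≤ h) (hS : ∀ x y, (x, y) ∈ E → ℓ (x, y) < 0 → x ∈ S)
    (hclosed : ∀ v l, IsWalkFrom E l v v → 0 ≤ walkLen ℓ l)
    (hproper : ∀ s ∈ S, ∀ t ∈ S, ∀ l, IsWalkFrom E l s t → hops ℓ l = h → (negTails ℓ l).Nodup →
      0 ≤ walkLen ℓ l)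
    (v : V) (l : List V) (hl : IsWalk E l) (hv : l.getLast? = some v) :
    0 ≤ walkLen ℓ l ∨
      ∃ s ∈ S, ∃ l', IsWalkFrom E l' s v ∧ hops ℓ l' ≤ h + 1 ∧ walkLen ℓ l' ≤ walkLen ℓ l := by
  induction hn : l.length using Nat.strong_induction_on generalizing l with
  | _ n ih =>
  subst hn
  have shorten (m : List V) (hm : IsWalk E m) (hmv : m.getLast? = some v)
      (hlt : m.length < l.length) (hle : walkLen ℓ m ≤ walkLen ℓ l) :
      0 ≤ walkLen ℓ l ∨
        ∃ s ∈ S, ∃ l', IsWalkFrom E l' s v ∧ hops ℓ l' ≤ h + 1 ∧ walkLen ℓ l' ≤ walkLen ℓ l := by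
    rcases ih _ hlt m hm hmv rfl with h0 | ⟨s, hs, l', h1, h2, h3⟩
    · exact .inl (h0.trans hle)
    · exact .inr ⟨s, hs, l', h1, h2, h3.trans hle⟩
  by_cases hnd : l.Nodup
  · match l, hl, hv, hnd, shorten with
    | [], hl, _, _, _ => exact absurd rfl hl.1
    | [u], _, _, _, _ => exact .inl (walkLen_singleton ℓ u).ge
    | u :: w :: m, hl, hv, hnd, shorten =>
      by_cases huw : ℓ (u, w) < 0
      · have hu : u ∈ S := hS u w (List.isChain_cons_cons.1 hl.2).1 huw
        by_cases hfew : hops ℓ (u :: w :: m) ≤ h + 1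
        · exact .inr ⟨u, hu, _, ⟨hl, rfl, hv⟩, hfew, le_rfl⟩
        · obtain ⟨a, x, y, b, hab, hxy, hax⟩ :=
            exists_split_of_lt_hops ℓ (u :: w :: m) h (by omega)
          rw [hab] at hl hv hnd shorten ⊢
          obtain ⟨hl₁, hl₂⟩ := (isWalk_append_cons_iff E a x (y :: b)).1 hl
          have hx : x ∈ S := hS x y (List.isChain_cons_cons.1 hl₂.2).1 hxy
          have ha : a ≠ [] := by
            rintro rfl
            simp only [List.nil_append, hops_singleton] at hax
            omega
          have hhead : (a ++ [x]).head? = some u := by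
            cases a with
            | nil => exact absurd rfl ha
            | cons c a => simp [(List.cons.inj hab).1]
          have hsub : (a ++ [x]).Sublist (a ++ x :: y :: b) := by simp
          have h0 := hproper u hu x hx (a ++ [x]) ⟨hl₁, hhead, by simp⟩ hax
            ((hnd.sublist hsub).sublist (negTails_sublist ℓ _))
          refine shorten _ hl₂ (by simpa using hv) ?_ ?_
          · simpa using List.length_pos_iff.2 ha
          · rw [walkLen_append_cons]
            linarith
      · refine shorten (w :: m) ⟨by simp, (List.isChain_cons_cons.1 hl.2).2⟩ (by simpa using hv)
          (by simp) ?_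
        rw [walkLen_cons_cons]
        linarith
  · obtain ⟨a, x, b, c, rfl⟩ := List.exists_split_of_not_nodup hnd
    obtain ⟨hl₁, hl₂⟩ := (isWalk_append_cons_iff E a x _).1 hl
    obtain ⟨hl₂, hl₃⟩ := (isWalk_append_cons_iff E (x :: b) x c).1 hl₂
    have h0 := hclosed x (x :: b ++ [x]) ⟨hl₂, rfl, List.getLast?_concat⟩
    refine shorten (a ++ x :: c) ((isWalk_append_cons_iff E a x c).2 ⟨hl₁, hl₃⟩) ?_ ?_ ?_
    · simpa [List.getLast?_append, List.getLast?_cons] using hv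
    · simp
    · have hcut := walkLen_append_cons ℓ (x :: b) x c
      rw [List.cons_append] at hcut
      rw [walkLen_append_cons ℓ a x c, walkLen_append_cons ℓ a x (b ++ x :: c)]
      linarith

/-- For every `S ⊆ N` and every `h ≥ 1`, in the graph `G_S`
(obtained by deleting every negative edge whose tail is not in `S`), either there is a
negative closed walk, or there are `s, t ∈ S` with proper `h`-hop distance `< 0`,
or `d(V, v) = min (0, d^{h+1}(S, v))` for every vertex `v`. -/
theorem statement1 {V : Type*} [Fintype V] (E : Set (V × V)) (ℓ : V × V → ℝ)
    (S : Set V) (hS : S ⊆ negVerts E ℓ) (h : ℕ) (hh : 1 ≤ h)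
    (ES : Set (V × V)) (hES : ES = {e ∈ E | 0 ≤ ℓ e ∨ e.1 ∈ S}) :
    (∃ (v : V) (l : List V), IsWalkFrom ES l v v ∧ walkLen ℓ l < 0) ∨
    (∃ s ∈ S, ∃ t ∈ S, properHopDist ES ℓ h s t < 0) ∨
    (∀ v : V, (⨅ u : V, dist' ES ℓ u v)
      = min 0 (hopDistFromSet ES ℓ (h + 1) S v)) := by
  by_contra! hcon
  obtain ⟨hclosed, hproper, v, hne⟩ := hcon
  refine hne (le_antisymm (le_min ?_ ?_) (le_iInf fun u => le_sInf ?_))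
  · exact iInf_le_of_le v <| sInf_le
      ⟨[v], ⟨⟨by simp, List.isChain_singleton v⟩, rfl, rfl⟩, by simp [walkLen_singleton]⟩
  · refine le_iInf₂ fun s _ => le_sInf ?_
    rintro _ ⟨l, hl, -, rfl⟩
    exact iInf_le_of_le s (sInf_le ⟨l, hl, rfl⟩)
  · rintro _ ⟨l, hl, rfl⟩
    rcases nonneg_or_exists_walk_few_hops ES ℓ S h hh
      (fun x y hxy hneg => by
        rw [hES] at hxy
        exact hxy.2.resolve_left hneg.not_ge)
      hclosed
      (fun s hs t ht l hl hhop hnd => by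
        have := (hproper s hs t ht).trans (sInf_le ⟨l, hl, hhop, hnd, rfl⟩)
        exact_mod_cast this)
      v l hl.1 hl.2.2 with h0 | ⟨s, hs, l', h1, h2, h3⟩
    · exact (min_le_left _ _).trans (by exact_mod_cast h0)
    · refine (min_le_right _ _).trans (iInf₂_le_of_le s hs ?_)
      exact sInf_le_of_le ⟨l', h1, h2, rfl⟩ (by exact_mod_cast h3)
end

section
/- Let h ∈ ℕ, let s, t ∈ V, and let W be a walk from s to t containing exactly h+1 negative edges such that ℓ(W) < d^h(s,t). If two distinct occurrences of negative edges on W have the same tail u, then the closed subwalk of W from the first of these two occurrences of u to the second is a closed walk of negative length. -/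
open scoped Classical

variable {V : Type*}

theorem walkEdges_append_cons {V : Type*} (p : List V) (u : V) (q : List V) :
    walkEdges (p ++ u :: q) = walkEdges (p ++ [u]) ++ walkEdges (u :: q) := by
  induction p with
  | nil => simp [walkEdges]
  | cons a p ih =>
    cases p with
    | nil => simp [walkEdges]
    | cons b p => simpa [walkEdges] using ih

theorem walkLen_append_cons_s2 {V : Type*} (ℓ : V × V → ℝ) (p : List V) (u : V) (q : List V) :
    walkLen ℓ (p ++ u :: q) = walkLen ℓ (p ++ [u]) + walkLen ℓ (u :: q) := by
  simp [walkLen, walkEdges_append_cons p u q]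

theorem hops_append_cons {V : Type*} (ℓ : V × V → ℝ) (p : List V) (u : V) (q : List V) :
    hops ℓ (p ++ u :: q) = hops ℓ (p ++ [u]) + hops ℓ (u :: q) := by
  simp [hops, negTails, walkEdges_append_cons p u q]

theorem hops_cons_cons_pos {V : Type*} (ℓ : V × V → ℝ) (u v : V) (q : List V)
    (huv : ℓ (u, v) < 0) : 0 < hops ℓ (u :: v :: q) := by
  simp [hops, negTails, walkEdges, huv]

theorem isWalk_append_cons {V : Type*} (E : Set (V × V)) (p : List V) (u : V) (q : List V) :
    IsWalk E (p ++ u :: q) ↔ IsWalk E (p ++ [u]) ∧ IsWalk E (u :: q) := by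
  simp only [IsWalk, List.Chain', ne_eq, List.append_eq_nil_iff, reduceCtorEq, and_false,
    not_false_eq_true, true_and]
  exact (List.isChain_split : List.IsChain (fun a b => (a, b) ∈ E) (p ++ u :: q) ↔ _)

/-- A closed subwalk with at least one hop is negative when the whole walk, of `h + 1` hops, is
shorter than the `h`-hop distance: otherwise cutting it out would give a walk of at most `h` hops
that is no longer. -/
theorem closed_subwalk_neg {V : Type*} (E : Set (V × V)) (ℓ : V × V → ℝ)
    (h : ℕ) (s t u : V) (p m q : List V)
    (hW : IsWalkFrom E (p ++ u :: (m ++ u :: q)) s t)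
    (hhops : hops ℓ (p ++ u :: (m ++ u :: q)) = h + 1)
    (hshort : (walkLen ℓ (p ++ u :: (m ++ u :: q)) : EReal) < hopDist E ℓ h s t)
    (hpos : 0 < hops ℓ (u :: m ++ [u])) :
    IsWalkFrom E (u :: m ++ [u]) u u ∧ walkLen ℓ (u :: m ++ [u]) < 0 := by
  obtain ⟨hwalk, hs, ht⟩ := hW
  rw [isWalk_append_cons, ← List.cons_append, isWalk_append_cons E (u :: m)] at hwalk
  obtain ⟨hp, hm, hq⟩ := hwalk
  refine ⟨⟨hm, by simp, List.getLast?_concat⟩, ?_⟩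
  rw [hops_append_cons, ← List.cons_append, hops_append_cons ℓ (u :: m)] at hhops
  by_contra! hnonneg
  have hcut : IsWalkFrom E (p ++ u :: q) s t := by
    refine ⟨(isWalk_append_cons E p u q).2 ⟨hp, hq⟩, ?_, ?_⟩
    · cases p <;> simpa using hs
    · rw [← ht]
      simp [List.getLast?_append, List.getLast?_cons]
  have hcut_hops : hops ℓ (p ++ u :: q) ≤ h := by
    rw [hops_append_cons]
    omega
  have hle : hopDist E ℓ h s t ≤ (walkLen ℓ (p ++ u :: q) : ℝ) :=
    sInf_le ⟨_, hcut, hcut_hops, rfl⟩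
  have hlt := EReal.coe_lt_coe_iff.1 (hshort.trans_le hle)
  rw [walkLen_append_cons_s2, ← List.cons_append, walkLen_append_cons_s2 ℓ (u :: m),
    walkLen_append_cons_s2 ℓ p u q] at hlt
  linarith

/-- Let `W` be a walk from `s` to `t` with exactly `h+1` negative edges
and `ℓ(W) < d^h(s,t)`. If two distinct occurrences of negative edges on `W` (at positions
`i < j`) have the same tail, then the closed subwalk of `W` from the first occurrence to
the second is a closed walk of negative length. -/
theorem statement2 {V : Type*} [Fintype V] (E : Set (V × V)) (ℓ : V × V → ℝ)
    (h : ℕ) (s t : V) (l : List V) (hW : IsWalkFrom E l s t)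
    (hhops : hops ℓ l = h + 1)
    (hshort : (walkLen ℓ l : EReal) < hopDist E ℓ h s t)
    (i j : ℕ) (hij : i < j) (hj : j + 1 < l.length)
    (hnegi : ℓ (l[i]'(by omega), l[i + 1]'(by omega)) < 0)
    (hnegj : ℓ (l[j]'(by omega), l[j + 1]'(by omega)) < 0)
    (htail : l[i]'(by omega) = l[j]'(by omega)) :
    IsWalkFrom E ((l.drop i).take (j - i + 1)) (l[i]'(by omega)) (l[i]'(by omega)) ∧
    walkLen ℓ ((l.drop i).take (j - i + 1)) < 0 := by
  have hm : (l.drop i).take (j - i + 1) =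
      l[i] :: (l.drop (i + 1)).take (j - (i + 1)) ++ [l[i]] := by
    rw [List.drop_eq_getElem_cons (by omega : i < l.length), List.take_succ_cons,
      List.cons_append, show j - i = j - (i + 1) + 1 by omega, htail, List.take_add_one]
    simp [show i + 1 + (j - (i + 1)) = j by omega, show j < l.length by omega]
  have hl : l = l.take i ++ l[i] ::
      ((l.drop (i + 1)).take (j - (i + 1)) ++ l[i] :: l.drop (j + 1)) := by
    conv_lhs =>
      rw [← List.take_append_drop i l, List.drop_eq_getElem_cons (by omega : i < l.length),
        ← List.take_append_drop (j - (i + 1)) (l.drop (i + 1)), List.drop_drop,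
        show i + 1 + (j - (i + 1)) = j by omega,
        List.drop_eq_getElem_cons (by omega : j < l.length), ← htail]
  have hpos : 0 < hops ℓ ((l.drop i).take (j - i + 1)) := by
    rw [List.drop_eq_getElem_cons (by omega : i < l.length),
      List.drop_eq_getElem_cons (by omega : i + 1 < l.length),
      show j - i + 1 = j - (i + 1) + 1 + 1 by omega, List.take_succ_cons, List.take_succ_cons]
    exact hops_cons_cons_pos ℓ _ _ _ hnegi
  rw [hm] at hpos ⊢
  generalize l[i] = u at *
  rw [hl] at hW hhops hshort
  exact closed_subwalk_neg E ℓ h s t u _ _ _ hW hhops hshort hpos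
end

section
/- Let S ⊆ V contain the tail of every negative edge of G, let h ≥ 1, let t ∈ V, and let W be a walk from some vertex s ∈ S to t containing exactly h+1 negative edges whose tails, in order of occurrence along W, are s₀, s₁, …, s_h and are pairwise distinct. If ℓ(W) < d^h(S,t), then the subwalk of W beginning with its first negative edge and ending immediately before its last negative edge is a proper h-hop walk from s₀ to s_h of negative length; in particular s₀, s_h ∈ S and \hat d^h(s₀,s_h) < 0. -/
open scoped Classical

variable {V : Type*}

theorem walkEdges_drop (k : ℕ) (l : List V) :
    walkEdges (l.drop k) = (walkEdges l).drop k := by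
  simp only [walkEdges, List.zip, List.drop_zipWith, List.tail_drop, List.drop_tail]

theorem walkEdges_take (k : ℕ) (l : List V) :
    walkEdges (l.take (k + 1)) = (walkEdges l).take k := by
  apply List.ext_getElem <;> simp [walkEdges]
  omega

theorem length_walkEdges (l : List V) : (walkEdges l).length = l.length - 1 := by
  simp [walkEdges]

theorem getElem_walkEdges (l : List V) (k : ℕ) (hk : k < (walkEdges l).length) :
    (walkEdges l)[k] =
      (l[k]'(by rw [length_walkEdges] at hk; omega),
        l[k + 1]'(by rw [length_walkEdges] at hk; omega)) := by
  simp [walkEdges]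

theorem walkLen_eq_take_add_drop (ℓ : V × V → ℝ) (l : List V) (k : ℕ) :
    walkLen ℓ l = walkLen ℓ (l.take (k + 1)) + walkLen ℓ (l.drop k) := by
  rw [walkLen, walkLen, walkLen, walkEdges_take, walkEdges_drop, ← List.sum_append,
    ← List.map_append, List.take_append_drop]

theorem negTails_eq_take_append_drop (ℓ : V × V → ℝ) (l : List V) (k : ℕ) :
    negTails ℓ l = negTails ℓ (l.take (k + 1)) ++ negTails ℓ (l.drop k) := by
  rw [negTails, negTails, negTails, walkEdges_take, walkEdges_drop, ← List.map_append,
    ← List.filter_append, List.take_append_drop]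

theorem negTails_eq_nil {ℓ : V × V → ℝ} {l : List V}
    (hl : ∀ e ∈ walkEdges l, ¬ ℓ e < 0) : negTails ℓ l = [] := by
  simpa [negTails] using hl

theorem walkLen_nonneg {ℓ : V × V → ℝ} {l : List V}
    (hl : ∀ e ∈ walkEdges l, ¬ ℓ e < 0) : 0 ≤ walkLen ℓ l :=
  List.sum_nonneg (List.forall_mem_map.2 fun e he => not_lt.1 (hl e he))

theorem not_neg_of_mem_walkEdges_take {ℓ : V × V → ℝ} {l : List V} {i : ℕ}
    (hfirst : ∀ k, (hk : k + 1 < l.length) → k < i → ¬ ℓ (l[k], l[k + 1]) < 0) :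
    ∀ e ∈ walkEdges (l.take (i + 1)), ¬ ℓ e < 0 := by
  intro e he
  rw [walkEdges_take] at he
  obtain ⟨k, hk, rfl⟩ := List.mem_iff_getElem.1 he
  rw [List.length_take, length_walkEdges] at hk
  rw [List.getElem_take, getElem_walkEdges]
  exact hfirst k (by omega) (by omega)

theorem not_neg_of_mem_walkEdges_drop {ℓ : V × V → ℝ} {l : List V} {j : ℕ}
    (hlast : ∀ k, (hk : k + 1 < l.length) → j < k → ¬ ℓ (l[k], l[k + 1]) < 0) :
    ∀ e ∈ walkEdges (l.drop (j + 1)), ¬ ℓ e < 0 := by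
  intro e he
  rw [walkEdges_drop] at he
  obtain ⟨k, hk, rfl⟩ := List.mem_iff_getElem.1 he
  rw [List.length_drop, length_walkEdges] at hk
  rw [List.getElem_drop, getElem_walkEdges]
  exact hlast (j + 1 + k) (by omega) (by omega)

theorem negTails_drop_of_last {ℓ : V × V → ℝ} {l : List V} {j : ℕ} (hj : j + 1 < l.length)
    (hneg : ℓ (l[j], l[j + 1]) < 0)
    (hlast : ∀ k, (hk : k + 1 < l.length) → j < k → ¬ ℓ (l[k], l[k + 1]) < 0) :
    negTails ℓ (l.drop j) = [l[j]] := by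
  have hnil := negTails_eq_nil (not_neg_of_mem_walkEdges_drop hlast)
  have hlen : j < (walkEdges l).length := by rw [length_walkEdges]; omega
  rw [negTails, walkEdges_drop] at hnil ⊢
  rw [List.drop_eq_getElem_cons hlen, getElem_walkEdges, List.filter_cons_of_pos (by simpa),
    List.map_cons, hnil]

theorem IsWalkFrom.drop {E : Set (V × V)} {l : List V} {s t : V} (hl : IsWalkFrom E l s t)
    (k : ℕ) (hk : k < l.length) : IsWalkFrom E (l.drop k) l[k] t := by
  refine ⟨⟨by simpa using hk, hl.1.2.drop k⟩, by simp [hk], ?_⟩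
  rw [List.getLast?_drop, if_neg (by omega), hl.2.2]

theorem IsWalkFrom.take {E : Set (V × V)} {l : List V} {s t : V} (hl : IsWalkFrom E l s t)
    (k : ℕ) (hk : k < l.length) : IsWalkFrom E (l.take (k + 1)) s l[k] := by
  refine ⟨⟨by simpa using hl.1.1, hl.1.2.take (k + 1)⟩,
    by simpa [List.head?_take] using hl.2.1, ?_⟩
  simp [List.getLast?_take, hk]

theorem IsWalkFrom.getElem_mem_negVerts {E : Set (V × V)} {ℓ : V × V → ℝ} {l : List V}
    {s t : V} (hl : IsWalkFrom E l s t) {k : ℕ} (hk : k + 1 < l.length)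
    (hneg : ℓ (l[k], l[k + 1]) < 0) : l[k] ∈ negVerts E ℓ :=
  ⟨l[k + 1], List.isChain_iff_getElem.1 hl.1.2 k hk, hneg⟩

theorem hopDistFromSet_le {E : Set (V × V)} {ℓ : V × V → ℝ} {r : ℕ} {S : Set V} {l : List V}
    {s t : V} (hs : s ∈ S) (hl : IsWalkFrom E l s t) (hr : hops ℓ l ≤ r) :
    hopDistFromSet E ℓ r S t ≤ (walkLen ℓ l : EReal) :=
  (iInf₂_le s hs).trans (sInf_le ⟨l, hl, hr, rfl⟩)

theorem properHopDist_le {E : Set (V × V)} {ℓ : V × V → ℝ} {h : ℕ} {l : List V} {s t : V}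
    (hl : IsWalkFrom E l s t) (hh : hops ℓ l = h) (hnodup : (negTails ℓ l).Nodup) :
    properHopDist E ℓ h s t ≤ (walkLen ℓ l : EReal) :=
  sInf_le ⟨l, hl, hh, hnodup, rfl⟩

/-- Let `S` contain the tail of every negative edge, `h ≥ 1`, and let
`W` be a walk from `s ∈ S` to `t` with exactly `h+1` negative edges whose tails are
pairwise distinct, with `ℓ(W) < d^h(S,t)`. Let position `i` carry the first negative edge
of `W` and position `j` the last. Then the subwalk of `W` from position `i` to position
`j` (beginning with the first negative edge, ending immediately before the last one) is a
proper `h`-hop walk from `s₀ = W[i]` to `s_h = W[j]` of negative length; in particular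
`s₀, s_h ∈ S` and the proper `h`-hop distance from `s₀` to `s_h` is negative. -/
theorem statement3 {V : Type*} [Fintype V] (E : Set (V × V)) (ℓ : V × V → ℝ)
    (S : Set V) (hS : negVerts E ℓ ⊆ S) (h : ℕ) (hh : 1 ≤ h)
    (s t : V) (hs : s ∈ S) (l : List V) (hW : IsWalkFrom E l s t)
    (hhops : hops ℓ l = h + 1) (hdistinct : (negTails ℓ l).Nodup)
    (hshort : (walkLen ℓ l : EReal) < hopDistFromSet E ℓ h S t)
    (i j : ℕ) (hij : i < j) (hj : j + 1 < l.length)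
    (hnegi : ℓ (l[i]'(by omega), l[i + 1]'(by omega)) < 0)
    (hfirst : ∀ k, (hk : k + 1 < l.length) → k < i → ¬ ℓ (l[k], l[k + 1]) < 0)
    (hnegj : ℓ (l[j]'(by omega), l[j + 1]'(by omega)) < 0)
    (hlast : ∀ k, (hk : k + 1 < l.length) → j < k → ¬ ℓ (l[k], l[k + 1]) < 0) :
    IsWalkFrom E ((l.drop i).take (j - i + 1)) (l[i]'(by omega)) (l[j]'(by omega)) ∧
    hops ℓ ((l.drop i).take (j - i + 1)) = h ∧
    (negTails ℓ ((l.drop i).take (j - i + 1))).Nodup ∧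
    walkLen ℓ ((l.drop i).take (j - i + 1)) < 0 ∧
    l[i]'(by omega) ∈ S ∧ l[j]'(by omega) ∈ S ∧
    properHopDist E ℓ h (l[i]'(by omega)) (l[j]'(by omega)) < 0 := by
  have hiS := hS (hW.getElem_mem_negVerts (by omega) hnegi)
  have hjS := hS (hW.getElem_mem_negVerts hj hnegj)
  have hdrop : (l.drop i).drop (j - i) = l.drop j := by
    rw [List.drop_drop]; congr 1; omega
  have hwalk : IsWalkFrom E ((l.drop i).take (j - i + 1)) (l[i]'(by omega))
      (l[j]'(by omega)) := by
    have hij' : (l.drop i)[j - i]'(by simp; omega) = l[j] := by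
      simp [Nat.add_sub_cancel' hij.le]
    simpa only [hij'] using (hW.drop i (by omega)).take (j - i) (by simp; omega)
  have htail := negTails_drop_of_last hj hnegj hlast
  have hsplit : negTails ℓ l = negTails ℓ ((l.drop i).take (j - i + 1)) ++ [l[j]] := by
    rw [negTails_eq_take_append_drop ℓ l i,
      negTails_eq_nil (not_neg_of_mem_walkEdges_take hfirst), List.nil_append,
      negTails_eq_take_append_drop ℓ (l.drop i) (j - i), hdrop, htail]
  have hh' : hops ℓ ((l.drop i).take (j - i + 1)) = h := by
    rw [hops, hsplit, List.length_append, List.length_singleton] at hhops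
    exact Nat.succ.inj hhops
  have hnodup : (negTails ℓ ((l.drop i).take (j - i + 1))).Nodup := by
    rw [hsplit] at hdistinct
    exact hdistinct.of_append_left
  have hlen : walkLen ℓ ((l.drop i).take (j - i + 1)) < 0 := by
    have hlt : walkLen ℓ l < walkLen ℓ (l.drop j) := EReal.coe_lt_coe_iff.1 <|
      hshort.trans_le <| hopDistFromSet_le hjS (hW.drop j (by omega)) (by simpa [hops, htail])
    have hprefix := walkLen_nonneg (not_neg_of_mem_walkEdges_take hfirst)
    have h₁ := walkLen_eq_take_add_drop ℓ l i
    have h₂ := walkLen_eq_take_add_drop ℓ (l.drop i) (j - i)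
    rw [hdrop] at h₂
    linarith
  exact ⟨hwalk, hh', hnodup, hlen, hiS, hjS,
    (properHopDist_le hwalk hh' hnodup).trans_lt (by exact_mod_cast hlen)⟩
end
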